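/- Let G be the 123-trimethylcyclohexane graph: the simple graph on vertices {1,...,9} whose edges are the 6-cycle {1,2},{2,3},{3,4},{4,5},{5,6},{6,1} together with pendant edges {1,7},{2,8},{3,9} attached at three consecutive cycle vertices. Then the edge ideal I(G) is not bridge-friendly. -/

import Mathlib

/-- The "lcm" of a collection of supports of squarefree monomials: the union. -/
def lcmU {α : Type*} [DecidableEq α] (σ : Finset (Finset α)) : Finset α := σ.sup id

/-- `m` is a bridge of `σ`: `m ∈ σ` and removing `m` does not change the lcm. -/
def IsBridge {α : Type*} [DecidableEq α] (σ : Finset (Finset α)) (m : Finset α) : Prop :=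
  m ∈ σ ∧ lcmU (σ.erase m) = lcmU σ

/-- `m` is a gap of `σ` (relative to the generating set `M`): `m ∈ M`, `m ∉ σ`,
and adding `m` does not change the lcm. -/
def IsGap {α : Type*} [DecidableEq α] (M : Set (Finset α)) (σ : Finset (Finset α))
    (m : Finset α) : Prop :=
  m ∈ M ∧ m ∉ σ ∧ lcmU (insert m σ) = lcmU σ

/-- `m` is a true gap of `σ` w.r.t. the total order encoded by `ord`
(`a` dominates `b` iff `ord b < ord a`). -/
def IsTrueGap {α : Type*} [DecidableEq α] (M : Set (Finset α)) (ord : Finset α → ℕ)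
    (σ : Finset (Finset α)) (m : Finset α) : Prop :=
  IsGap M σ m ∧ ∀ m', IsBridge (insert m σ) m' → ord m' < ord m → IsBridge σ m'

/-- `σ` is potentially-type-2: it has a bridge dominating no true gap of `σ`. -/
def PotType2 {α : Type*} [DecidableEq α] (M : Set (Finset α)) (ord : Finset α → ℕ)
    (σ : Finset (Finset α)) : Prop :=
  ∃ m, IsBridge σ m ∧ ∀ g, IsTrueGap M ord σ g → ¬ ord g < ord m

/-- `b` is the smallest bridge of `σ` w.r.t. the total order encoded by `ord`. -/
def IsSBridge {α : Type*} [DecidableEq α] (ord : Finset α → ℕ) (σ : Finset (Finset α))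
    (b : Finset α) : Prop :=
  IsBridge σ b ∧ ∀ b', IsBridge σ b' → ord b ≤ ord b'

/-- `σ` is type-2: it is potentially-type-2, and any other potentially-type-2 `σ'` with
`σ' \ {sbridge σ'} = σ \ {sbridge σ}` satisfies `sbridge σ' ≻ sbridge σ`. -/
def Type2 {α : Type*} [DecidableEq α] (M : Set (Finset α)) (ord : Finset α → ℕ)
    (σ : Finset (Finset α)) : Prop :=
  PotType2 M ord σ ∧ ∀ σ' : Finset (Finset α), ↑σ' ⊆ M → σ' ≠ σ → PotType2 M ord σ' →
    ∀ b b', IsSBridge ord σ b → IsSBridge ord σ' b' → σ'.erase b' = σ.erase b →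
      ord b < ord b'

/-- `M` (an antichain of supports of the minimal generators of a squarefree monomial
ideal) is bridge-friendly: there is a total order on `M` (encoded by an injection
`ord : Finset α → ℕ`, where `a ≻ b` iff `ord b < ord a`) for which every
potentially-type-2 subset of `M` is type-2. -/
def BridgeFriendly {α : Type*} [DecidableEq α] (M : Set (Finset α)) : Prop :=
  ∃ ord : Finset α → ℕ, Set.InjOn ord M ∧
    ∀ σ : Finset (Finset α), ↑σ ⊆ M → PotType2 M ord σ → Type2 M ord σ

section BridgeFriendly

variable {α : Type*} [DecidableEq α]

theorem pair_eq_pair_iff {a b c d : α} :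
    ({a, b} : Finset α) = {c, d} ↔ a = c ∧ b = d ∨ a = d ∧ b = c := by
  rw [← Finset.coe_inj]
  push_cast
  exact Set.pair_eq_pair_iff

theorem mem_lcmU {σ : Finset (Finset α)} {v : α} : v ∈ lcmU σ ↔ ∃ m ∈ σ, v ∈ m := by
  simp [lcmU]

theorem isBridge_iff {σ : Finset (Finset α)} {m : Finset α} :
    IsBridge σ m ↔ m ∈ σ ∧ ∀ v ∈ m, ∃ m' ∈ σ, m' ≠ m ∧ v ∈ m' := by
  refine and_congr_right fun hm => ⟨fun h v hv => ?_, fun h => ?_⟩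
  · have hv' : v ∈ lcmU (σ.erase m) := h ▸ mem_lcmU.2 ⟨m, hm, hv⟩
    obtain ⟨m', hm', hvm'⟩ := mem_lcmU.1 hv'
    exact ⟨m', Finset.mem_of_mem_erase hm', Finset.ne_of_mem_erase hm', hvm'⟩
  · refine (Finset.sup_mono (Finset.erase_subset m σ)).antisymm fun v hv => ?_
    obtain ⟨n, hn, hvn⟩ := mem_lcmU.1 hv
    by_cases hnm : n = m
    · obtain ⟨m', hm', hne, hvm'⟩ := h v (hnm ▸ hvn)
      exact mem_lcmU.2 ⟨m', Finset.mem_erase.2 ⟨hne, hm'⟩, hvm'⟩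
    · exact mem_lcmU.2 ⟨n, Finset.mem_erase.2 ⟨hnm, hn⟩, hvn⟩

theorem IsGap.subset_lcmU {M : Set (Finset α)} {σ : Finset (Finset α)} {m : Finset α}
    (h : IsGap M σ m) : m ⊆ lcmU σ := fun _ hv =>
  h.2.2 ▸ mem_lcmU.2 ⟨m, Finset.mem_insert_self m σ, hv⟩

/-- On a path `a b c d e f`, the edge `bc` is the only bridge of the set of all path edges
but `de`. -/
theorem isBridge_path_iff {a b c d e f : α} (hp : [a, b, c, d, e, f].Nodup) {m : Finset α} :
    IsBridge {{a, b}, {b, c}, {c, d}, {e, f}} m ↔ m = {b, c} := by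
  simp only [List.nodup_cons, List.mem_cons, List.not_mem_nil, not_or, or_false] at hp
  obtain ⟨⟨hab, hac, had, hae, haf⟩, ⟨hbc, hbd, hbe, hbf⟩, ⟨hcd, hce, hcf⟩, 
    ⟨hde, hdf⟩, hef, -⟩ := hp
  rw [isBridge_iff]
  simp only [Finset.mem_insert, Finset.mem_singleton]
  constructor
  · rintro ⟨rfl | rfl | rfl | rfl, h⟩
    · have := h a (by simp); grind
    · rfl
    · have := h d (by simp); grind
    · have := h e (by simp); grind
  · rintro rfl
    refine ⟨by simp, ?_⟩
    intro v hv
    rw [Finset.mem_insert, Finset.mem_singleton] at hv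
    rcases hv with rfl | rfl
    · exact ⟨{a, v}, by simp, by grind [pair_eq_pair_iff], by simp⟩
    · exact ⟨{v, d}, by simp, by grind [pair_eq_pair_iff], by simp⟩

/-- If the middle edge `cd` of an induced path `a b c d e f` precedes `de`, then the set of all
path edges but `de` has no true gap, and hence is potentially-type-2. -/
theorem potType2_path {M : Set (Finset α)} {ord : Finset α → ℕ} {a b c d e f : α}
    (hp : [a, b, c, d, e, f].Nodup)
    (hM : ∀ m ∈ M, m ⊆ {a, b, c, d, e, f} →
      m = {a, b} ∨ m = {b, c} ∨ m = {c, d} ∨ m = {d, e} ∨ m = {e, f})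
    (hlt : ord {c, d} < ord {d, e}) :
    PotType2 M ord {{a, b}, {b, c}, {c, d}, {e, f}} := by
  refine ⟨{b, c}, (isBridge_path_iff hp).2 rfl, fun g hg _ => ?_⟩
  have hsub : g ⊆ {a, b, c, d, e, f} := fun v hv => by
    obtain ⟨m, hm, hvm⟩ := mem_lcmU.1 (hg.1.subset_lcmU hv)
    grind
  have hnot := hg.1.2.1
  have hgde : g = {d, e} := by
    rcases hM g hg.1.1 hsub with h | h | h | h | h <;> simp_all
  subst hgde
  have hne : ({c, d} : Finset α) ≠ {b, c} := by
    simp only [List.nodup_cons, List.mem_cons, List.not_mem_nil, not_or, or_false] at hp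
    grind
  refine hne ((isBridge_path_iff hp).1 (hg.2 {c, d} (isBridge_iff.2 ⟨by simp, ?_⟩) hlt))
  simp only [List.nodup_cons, List.mem_cons, List.not_mem_nil, not_or, or_false] at hp
  intro v hv
  rw [Finset.mem_insert, Finset.mem_singleton] at hv
  rcases hv with rfl | rfl
  · exact ⟨{b, v}, by simp, by grind [pair_eq_pair_iff], by simp⟩
  · exact ⟨{v, e}, by simp, by grind [pair_eq_pair_iff], by simp⟩

/-- Under an order witnessing bridge-friendliness, the middle edge of an induced path with five
edges cannot precede both of its neighbours. -/
theorem not_middle_lt_of_induced_path {M : Set (Finset α)} {ord : Finset α → ℕ}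
    (h : ∀ σ : Finset (Finset α), ↑σ ⊆ M → PotType2 M ord σ → Type2 M ord σ)
    (a b c d e f : α) (hp : [a, b, c, d, e, f].Nodup)
    (hM : ∀ m ∈ M, m ⊆ {a, b, c, d, e, f} →
      m = {a, b} ∨ m = {b, c} ∨ m = {c, d} ∨ m = {d, e} ∨ m = {e, f})
    (hE : {a, b} ∈ M ∧ {b, c} ∈ M ∧ {c, d} ∈ M ∧ {d, e} ∈ M ∧ {e, f} ∈ M)
    (h₁ : ord {c, d} < ord {b, c}) (h₂ : ord {c, d} < ord {d, e}) : False := by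
  have hp' : [f, e, d, c, b, a].Nodup := by simpa using List.nodup_reverse.2 hp
  have hσ' : ({{f, e}, {e, d}, {d, c}, {b, a}} : Finset (Finset α)) =
      {{a, b}, {c, d}, {d, e}, {e, f}} := by
    simp only [Finset.pair_comm f e, Finset.pair_comm e d, Finset.pair_comm d c,
      Finset.pair_comm b a]
    grind
  have hP := potType2_path hp hM h₂
  have hP' : PotType2 M ord {{a, b}, {c, d}, {d, e}, {e, f}} := by
    rw [← hσ']
    refine potType2_path hp' (fun m hm hsub => ?_) ?_
    · have := hM m hm (hsub.trans (by intro v; simp; tauto))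
      simp only [Finset.pair_comm f e, Finset.pair_comm e d, Finset.pair_comm d c,
        Finset.pair_comm c b, Finset.pair_comm b a]
      tauto
    · rwa [Finset.pair_comm d c, Finset.pair_comm c b]
  have hS : IsSBridge ord {{a, b}, {b, c}, {c, d}, {e, f}} {b, c} :=
    ⟨(isBridge_path_iff hp).2 rfl, fun m hm => ((isBridge_path_iff hp).1 hm).symm ▸ le_rfl⟩
  have hS' : IsSBridge ord {{a, b}, {c, d}, {d, e}, {e, f}} {d, e} := by
    rw [← hσ', Finset.pair_comm d e]
    exact ⟨(isBridge_path_iff hp').2 rfl, fun m hm => ((isBridge_path_iff hp').1 hm).symm ▸ le_rfl⟩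
  have hsub : (({{a, b}, {b, c}, {c, d}, {e, f}} : Finset (Finset α)) : Set (Finset α)) ⊆ M := by
    intro m; simp; grind
  have hsub' : (({{a, b}, {c, d}, {d, e}, {e, f}} : Finset (Finset α)) : Set (Finset α)) ⊆ M := by
    intro m; simp; grind
  simp only [List.nodup_cons, List.mem_cons, List.not_mem_nil, not_or, or_false] at hp
  have hbc : ({b, c} : Finset α) ∉ ({{a, b}, {c, d}, {d, e}, {e, f}} : Finset (Finset α)) := by
    simp [pair_eq_pair_iff, hp, Ne.symm]
  have hde : ({d, e} : Finset α) ∉ ({{a, b}, {b, c}, {c, d}, {e, f}} : Finset (Finset α)) := by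
    simp [pair_eq_pair_iff, hp, Ne.symm]
  have hne : ({{a, b}, {c, d}, {d, e}, {e, f}} : Finset (Finset α)) ≠
      {{a, b}, {b, c}, {c, d}, {e, f}} := fun heq => hbc (by simp [heq])
  have herase : ({{a, b}, {c, d}, {d, e}, {e, f}} : Finset (Finset α)).erase {d, e} =
      ({{a, b}, {b, c}, {c, d}, {e, f}} : Finset (Finset α)).erase {b, c} := by
    ext m
    simp only [Finset.mem_erase, Finset.mem_insert, Finset.mem_singleton] at hbc hde ⊢
    clear * - hbc hde
    grind
  exact lt_asymm ((h _ hsub hP).2 _ hsub' hne hP' _ _ hS hS' herase)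
    ((h _ hsub' hP').2 _ hsub hne.symm hP _ _ hS' hS herase.symm)

end BridgeFriendly

/-- The edge ideal of the 123-trimethylcyclohexane graph (a 6-cycle `0-1-2-3-4-5` with
pendant vertices `6, 7, 8` attached to the three consecutive cycle vertices `0, 1, 2`)
is not bridge-friendly.  (Vertices `1,…,9` of the statement are relabelled `0,…,8`.) -/
theorem trimethyl123_not_bridgeFriendly :
    ¬ BridgeFriendly ({{0, 1}, {1, 2}, {2, 3}, {3, 4}, {4, 5}, {5, 0},
        {0, 6}, {1, 7}, {2, 8}} : Set (Finset (Fin 9))) := by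
  rintro ⟨ord, hinj, h⟩
  have hM : ({{0, 1}, {1, 2}, {2, 3}, {3, 4}, {4, 5}, {5, 0}, {0, 6}, {1, 7}, {2, 8}} :
      Set (Finset (Fin 9))) = (({{0, 1}, {1, 2}, {2, 3}, {3, 4}, {4, 5}, {5, 0}, {0, 6}, {1, 7},
      {2, 8}} : Finset (Finset (Fin 9))) : Set (Finset (Fin 9))) := by
    push_cast
    rfl
  have path := not_middle_lt_of_induced_path h
  have h₁ := path 6 0 1 2 3 4 (by decide)
    (by simp only [hM, Finset.mem_coe]; decide +kernel)
    (by simp only [hM, Finset.mem_coe]; decide +kernel)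
  have h₂ := path 8 2 1 0 5 4 (by decide)
    (by simp only [hM, Finset.mem_coe]; decide +kernel)
    (by simp only [hM, Finset.mem_coe]; decide +kernel)
  have h₃ := path 7 1 2 3 4 5 (by decide)
    (by simp only [hM, Finset.mem_coe]; decide +kernel)
    (by simp only [hM, Finset.mem_coe]; decide +kernel)
  have h₄ := path 7 1 0 5 4 3 (by decide)
    (by simp only [hM, Finset.mem_coe]; decide +kernel)
    (by simp only [hM, Finset.mem_coe]; decide +kernel)
  have h₅ := path 6 0 5 4 3 2 (by decide)
    (by simp only [hM, Finset.mem_coe]; decide +kernel)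
    (by simp only [hM, Finset.mem_coe]; decide +kernel)
  have h₆ := path 8 2 3 4 5 0 (by decide)
    (by simp only [hM, Finset.mem_coe]; decide +kernel)
    (by simp only [hM, Finset.mem_coe]; decide +kernel)
  have hne {m n : Finset (Fin 9)} (hmn : m ≠ n) (hm : m ∈ _) (hn : n ∈ _) : ord m ≠ ord n :=
    fun heq => hmn (hinj hm hn heq)
  have n₁ : ord {0, 1} ≠ ord {1, 2} := hne (by decide) (by simp) (by simp)
  have n₂ : ord {1, 2} ≠ ord {2, 3} := hne (by decide) (by simp) (by simp)
  have n₃ : ord {2, 3} ≠ ord {3, 4} := hne (by decide) (by simp) (by simp)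
  have n₄ : ord {3, 4} ≠ ord {4, 5} := hne (by decide) (by simp) (by simp)
  have n₅ : ord {4, 5} ≠ ord {5, 0} := hne (by decide) (by simp) (by simp)
  have n₆ : ord {5, 0} ≠ ord {0, 1} := hne (by decide) (by simp) (by simp)
  simp only [Finset.pair_comm (2 : Fin 9) 1, Finset.pair_comm (1 : Fin 9) 0,
    Finset.pair_comm (0 : Fin 9) 5, Finset.pair_comm (5 : Fin 9) 4,
    Finset.pair_comm (4 : Fin 9) 3] at h₁ h₂ h₃ h₄ h₅ h₆
  lia
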